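/- For every compact set K ⊂ Ω there exists a constant C > 0, depending only on a, b, β and K, such that for every V : closure(Ω) → ℝ with a ≤ V ≤ b and every classical solution u of problem (P) relative to V one has ∫_K e^{u(x)} dx ≤ C. -/

import Mathlib

open MeasureTheory Real RealInnerProductSpace

noncomputable section

/-- The Euclidean plane ℝ². -/
abbrev E2 := EuclideanSpace ℝ (Fin 2)

/-- The open annulus `{x : R₂ < |x| < R₁}` centered at the origin. -/
def ann (R₂ R₁ : ℝ) : Set E2 := {x : E2 | R₂ < ‖x‖ ∧ ‖x‖ < R₁}

/-- `Ω`, the open annulus of radii 1/2 and 1 centered at the origin. -/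
def Omega : Set E2 := ann (1/2) 1

/-- The Laplacian `Δ = ∂₁₁ + ∂₂₂` on ℝ². -/
def lap (u : E2 → ℝ) (x : E2) : ℝ :=
  ∑ i : Fin 2,
    iteratedFDeriv ℝ 2 u x ![EuclideanSpace.single i 1, EuclideanSpace.single i 1]

/-- The point `r (cos θ, sin θ)` on the circle of radius `r`. -/
def circlePt (r θ : ℝ) : E2 :=
  (WithLp.equiv 2 (Fin 2 → ℝ)).symm ![r * Real.cos θ, r * Real.sin θ]

/-- Arc-length integral of `f` over the circle `C(r) = {x : |x| = r}` centered at the origin: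
`∫_{C(r)} f dσ = ∫_0^{2π} f(r cos θ, r sin θ) r dθ`. -/
def circleIntR (f : E2 → ℝ) (r : ℝ) : ℝ := ∫ θ in (0:ℝ)..(2 * π), f (circlePt r θ) * r

/-- A classical solution of problem (P): `u ∈ C²(closure Ω)`, `u = 0` on `∂Ω`, and
`-Δu = (1 + |x - x₀|^{2β}) V e^u` in `Ω`. -/
def IsSolP (β : ℝ) (x₀ : E2) (V u : E2 → ℝ) : Prop :=
  ContDiffOn ℝ 2 u (closure Omega) ∧
  (∀ x ∈ frontier Omega, u x = 0) ∧
  ∀ x ∈ Omega, -lap u x = (1 + ‖x - x₀‖ ^ (2 * β)) * V x * Real.exp (u x)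

/-- A classical solution of problem (P_β): `u ∈ C²(closure Ω)`, `u = 0` on `∂Ω`, and
`-Δu = |x - x₀|^{2β} V e^u` in `Ω`. -/
def IsSolPbeta (β : ℝ) (x₀ : E2) (V u : E2 → ℝ) : Prop :=
  ContDiffOn ℝ 2 u (closure Omega) ∧
  (∀ x ∈ frontier Omega, u x = 0) ∧
  ∀ x ∈ Omega, -lap u x = ‖x - x₀‖ ^ (2 * β) * V x * Real.exp (u x)

/-- Directional derivative. -/
def dirD (e : E2) (f : E2 → ℝ) : E2 → ℝ := fun x => fderiv ℝ f x e

lemma dirD_smooth (e : E2) {f : E2 → ℝ} {n m : WithTop ℕ∞} (hf : ContDiff ℝ n f)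
    (h : m + 1 ≤ n) : ContDiff ℝ m (dirD e f) :=
  (hf.fderiv_right h).clm_apply contDiff_const

lemma dirD_supp (e : E2) {f : E2 → ℝ} (hf : HasCompactSupport f) :
    HasCompactSupport (dirD e f) := by
  refine (hf.fderiv (𝕜 := ℝ)).mono' ?_
  refine (Function.support_subset_iff'.2 ?_).trans (subset_tsupport _)
  intro x hx
  simp only [Function.mem_support, not_not] at hx
  simp [dirD, hx]

lemma lap_eq {u : E2 → ℝ} {x : E2} (hu : ContDiffAt ℝ 2 u x) :
    lap u x = ∑ i : Fin 2, dirD (EuclideanSpace.single i 1)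
      (dirD (EuclideanSpace.single i 1) u) x := by
  unfold lap
  refine Finset.sum_congr rfl fun i _ => ?_
  rw [iteratedFDeriv_two_apply]
  have h1 : DifferentiableAt ℝ (fderiv ℝ u) x :=
    (hu.fderiv_right (m := 1) (by norm_num)).differentiableAt (by norm_num)
  have := fderiv_clm_apply h1 (differentiableAt_const (EuclideanSpace.single i (1:ℝ) : E2))
  change _ = fderiv ℝ (fun y => fderiv ℝ u y (EuclideanSpace.single i 1)) x _
  rw [this]
  simp

lemma intByParts (e : E2) {f g : E2 → ℝ} (hf : ContDiff ℝ 1 f) (hg : ContDiff ℝ 1 g)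
    (hfs : HasCompactSupport f) :
    ∫ x, f x * dirD e g x = - ∫ x, dirD e f x * g x := by
  have cf := (dirD_smooth e hf (m := 0) (by norm_num)).continuous
  have cg := (dirD_smooth e hg (m := 0) (by norm_num)).continuous
  refine integral_mul_fderiv_eq_neg_fderiv_mul_of_integrable ?_ ?_ ?_ ?_ ?_
  · exact (cf.mul hg.continuous).integrable_of_hasCompactSupport ((dirD_supp e hfs).mul_right)
  · exact (hf.continuous.mul cg).integrable_of_hasCompactSupport (hfs.mul_right)
  · exact (hf.continuous.mul hg.continuous).integrable_of_hasCompactSupport (hfs.mul_right)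
  · exact fun x _ => hf.differentiable (by norm_num) x
  · exact fun x _ => hg.differentiable (by norm_num) x

lemma intByParts2 (e : E2) {f g : E2 → ℝ} (hf : ContDiff ℝ 2 f) (hg : ContDiff ℝ 2 g)
    (hfs : HasCompactSupport f) :
    ∫ x, f x * dirD e (dirD e g) x = ∫ x, dirD e (dirD e f) x * g x := by
  rw [intByParts e (hf.of_le (by norm_num)) (dirD_smooth e hg (by norm_num)) hfs,
    intByParts e (dirD_smooth e hf (by norm_num)) (hg.of_le (by norm_num)) (dirD_supp e hfs),
    neg_neg]

lemma dirD_pow_four (e : E2) {ψ : E2 → ℝ} (hψ : ContDiff ℝ 2 ψ) (x : E2) :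
    dirD e (dirD e (fun y => ψ y ^ 4)) x
      = ψ x ^ 2 * (12 * dirD e ψ x ^ 2 + 4 * ψ x * dirD e (dirD e ψ) x) := by
  have h1 : ∀ y, HasFDerivAt ψ (fderiv ℝ ψ y) y := fun y =>
    (hψ.differentiable (by norm_num) y).hasFDerivAt
  have h2 : dirD e (fun y => ψ y ^ 4) = fun y => 4 * ψ y ^ 3 * dirD e ψ y := by
    ext y
    have := ((h1 y).pow 4).fderiv
    simp only [dirD]
    rw [this]
    simp
  have h3 : HasFDerivAt (dirD e ψ) (fderiv ℝ (dirD e ψ) x) x :=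
    ((dirD_smooth e hψ (m := 1) (by norm_num)).differentiable (by norm_num) x).hasFDerivAt
  rw [h2]
  have h4 := ((((h1 x).pow 3).const_mul 4).mul h3).fderiv
  change fderiv ℝ (fun y => 4 * ψ y ^ 3 * dirD e ψ y) x e = _
  rw [show (fun y => 4 * ψ y ^ 3 * dirD e ψ y) =
    (fun y => 4 * (ψ y ^ 3)) * dirD e ψ from rfl, h4]
  simp [dirD]
  ring

lemma dirD_bound (e : E2) {ψ : E2 → ℝ} (hψ : ContDiff ℝ 2 ψ) (hs : HasCompactSupport ψ) :
    ∃ C : ℝ, ∀ x, |dirD e (dirD e (fun y => ψ y ^ 4)) x| ≤ C * ψ x ^ 2 := by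
  have c0 := hψ.continuous
  have c1 := (dirD_smooth e hψ (m := 1) (by norm_num))
  have c2 := (dirD_smooth e c1 (m := 0) (by norm_num)).continuous
  have c3 := c1.continuous
  have hc : Continuous (fun x => 12 * dirD e ψ x ^ 2 + 4 * ψ x * dirD e (dirD e ψ) x) := by
    fun_prop
  have hK : IsCompact (tsupport ψ) := hs
  obtain ⟨C, hC⟩ := hK.exists_bound_of_continuousOn hc.continuousOn
  refine ⟨C, fun x => ?_⟩
  rw [dirD_pow_four e hψ, abs_mul, abs_of_nonneg (sq_nonneg _), mul_comm]
  by_cases hx : x ∈ tsupport ψ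
  · exact mul_le_mul_of_nonneg_right (hC x hx) (sq_nonneg _)
  · simp [image_eq_zero_of_notMem_tsupport hx]

lemma dirD_localMin (e : E2) {u : E2 → ℝ} {x : E2} (hu : ContDiffAt ℝ 2 u x)
    (hm : IsLocalMin u x) : 0 ≤ dirD e (dirD e u) x := by
  set l : ℝ → E2 := fun t => x + t • e with hl
  have hl0 : l 0 = x := by simp [hl]
  have hlc : Filter.Tendsto l (nhds 0) (nhds x) := by
    have : Continuous l := by fun_prop
    simpa [hl0] using this.tendsto 0
  have hld : ∀ t, HasDerivAt l e t := fun t => by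
    simpa [hl] using ((hasDerivAt_id t).smul_const e).const_add x
  have hev : ∀ᶠ y in nhds x, DifferentiableAt ℝ u y :=
    (hu.eventually (by simp)).mono fun y hy => hy.differentiableAt (by norm_num)
  have hd : deriv (u ∘ l) =ᶠ[nhds 0] (dirD e u) ∘ l := by
    filter_upwards [hlc.eventually hev] with t ht
    exact (ht.hasFDerivAt.comp_hasDerivAt t (hld t)).deriv
  have hdd : deriv (deriv (u ∘ l)) 0 = dirD e (dirD e u) x := by
    rw [hd.deriv_eq]
    have h1 : DifferentiableAt ℝ (dirD e u) x :=
      ((hu.fderiv_right (m := 1) (by norm_num)).differentiableAt (by norm_num)).clm_apply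
        (differentiableAt_const _)
    rw [← hl0] at h1
    have := (h1.hasFDerivAt.comp_hasDerivAt 0 (hld 0)).deriv
    rw [this, hl0]; rfl
  have hmin : IsLocalMin (u ∘ l) 0 := by
    have : ∀ᶠ y in nhds x, u x ≤ u y := hm
    have h2 := hlc.eventually this
    filter_upwards [h2] with t ht
    simpa [hl0] using ht
  by_contra hneg
  push Not at hneg
  have hcont : ContinuousAt (u ∘ l) 0 :=
    ContinuousAt.comp (by rw [hl0]; exact hu.continuousAt) (hld 0).continuousAt
  have hmax := isLocalMax_of_deriv_deriv_neg (by rw [hdd]; exact hneg) hmin.deriv_eq_zero hcont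
  have hconst : (u ∘ l) =ᶠ[nhds 0] fun _ => (u ∘ l) 0 := by
    filter_upwards [hmin, hmax] with t h1 h2
    exact le_antisymm h2 h1
  have : deriv (u ∘ l) =ᶠ[nhds 0] deriv (fun _ => (u ∘ l) 0) := hconst.deriv
  have h0 := this.deriv_eq
  rw [hdd] at h0
  simp at h0
  linarith

lemma isOpen_Omega : IsOpen Omega := by
  have : Omega = (fun x : E2 => ‖x‖) ⁻¹' Set.Ioo (1/2) 1 := rfl
  rw [this]
  exact isOpen_Ioo.preimage continuous_norm

lemma isCompact_closure_Omega : IsCompact (closure Omega) := by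
  refine Bornology.IsBounded.isCompact_closure ?_
  refine (Metric.isBounded_ball (x := (0:E2)) (r := 1)).subset fun x hx => ?_
  simpa using hx.2

lemma exists_cutoff {K U : Set E2} (hK : IsCompact K) (hU : IsOpen U) (hKU : K ⊆ U) :
    ∃ ψ : E2 → ℝ, ContDiff ℝ 2 ψ ∧ HasCompactSupport ψ ∧ tsupport ψ ⊆ U ∧
      (∀ x, 0 ≤ ψ x) ∧ ∀ᶠ x in nhdsSet K, ψ x = 1 := by
  obtain ⟨L, hL, hKL, hLU⟩ := exists_compact_between hK hU hKU
  obtain ⟨f, h0, h1, h2⟩ := exists_contMDiffMap_zero_one_nhds_of_isClosed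
    (modelWithCornersSelf ℝ E2) (n := 2)
    (isOpen_interior (s := L)).isClosed_compl hK.isClosed
    (by rwa [← Set.subset_compl_iff_disjoint_left, compl_compl])
  have hs : tsupport (f : E2 → ℝ) ⊆ L := by
    refine closure_minimal ?_ hL.isClosed
    refine Function.support_subset_iff'.2 fun x hx => ?_
    exact h0.self_of_nhdsSet _ fun hx' => hx (interior_subset hx')
  exact ⟨f, f.contMDiff.contDiff, hL.of_isClosed_subset (isClosed_tsupport _) hs,
    hs.trans hLU, fun x => (h2 x).1, h1⟩

lemma sol_nonneg {β a b : ℝ} (ha : 0 < a) {x₀ : E2} {V u : E2 → ℝ}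
    (hV : ∀ x ∈ closure Omega, a ≤ V x ∧ V x ≤ b) (hu : IsSolP β x₀ V u) :
    ∀ x ∈ Omega, 0 ≤ u x := by
  obtain ⟨h1, h2, h3⟩ := hu
  intro x hx
  obtain ⟨z, hz, hmin⟩ := isCompact_closure_Omega.exists_isMinOn ⟨x, subset_closure hx⟩
    h1.continuousOn
  refine le_trans ?_ (hmin (subset_closure hx))
  by_cases hzO : z ∈ Omega
  · exfalso
    have hn : closure Omega ∈ nhds z :=
      Filter.mem_of_superset (isOpen_Omega.mem_nhds hzO) subset_closure
    have hc := h1.contDiffAt hn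
    have hl := lap_eq hc
    have hp : 0 ≤ lap u z := by
      rw [hl]
      exact Finset.sum_nonneg fun i _ => dirD_localMin _ hc (hmin.isLocalMin hn)
    have h4 := h3 z hzO
    have h5 : 0 < V z := ha.trans_le (hV z hz).1
    have h6 : 0 < (1 + ‖z - x₀‖ ^ (2 * β)) * V z * Real.exp (u z) := by positivity
    linarith
  · exact (h2 z ⟨hz, by rwa [isOpen_Omega.interior_eq]⟩).ge

theorem local_volume_bound_P (β a b : ℝ) (hβ : 0 < β ∧ β < 1/2) (ha : 0 < a) (hab : a ≤ b)
    (K : Set E2) (hK : IsCompact K) (hKΩ : K ⊆ Omega) :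
    ∃ C > (0:ℝ), ∀ (x₀ : E2), ‖x₀‖ = 1/2 →
      ∀ V u : E2 → ℝ,
        (∀ x ∈ closure Omega, a ≤ V x ∧ V x ≤ b) →
        IsSolP β x₀ V u →
        ∫ x in K, Real.exp (u x) ≤ C := by
  obtain ⟨ψ, hψ, hψs, hψO, hψ0, hψ1⟩ := exists_cutoff hK isOpen_Omega hKΩ
  set L := tsupport ψ with hLdef
  have hL : IsCompact L := hψs
  obtain ⟨χ, hχ, hχs, hχO, hχ0, hχ1⟩ := exists_cutoff hL isOpen_Omega hψO
  have hKL : K ⊆ L := fun x hx => subset_tsupport _ (by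
    simp [hψ1.self_of_nhdsSet x hx])
  choose B hB using fun i : Fin 2 =>
    dirD_bound (EuclideanSpace.single i (1:ℝ) : E2) hψ hψs
  set φ : E2 → ℝ := fun y => ψ y ^ 4 with hφdef
  have hφ : ContDiff ℝ 2 φ := hψ.pow 4
  have hφz : ∀ x, x ∉ L → ψ x = 0 := fun x hx => image_eq_zero_of_notMem_tsupport hx
  have hφs : HasCompactSupport φ := HasCompactSupport.intro hL fun x hx => by
    simp [hφdef, hφz x hx]
  set Q : ℝ := B 0 + B 1 with hQ
  have hlapφ : ∀ x, |lap φ x| ≤ Q * ψ x ^ 2 := fun x => by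
    rw [lap_eq hφ.contDiffAt, Fin.sum_univ_two]
    refine (abs_add_le _ _).trans ?_
    have := hB 0 x
    have := hB 1 x
    linarith
  set M : ℝ := (2 * Q ^ 2 / a) * (volume L).toReal with hM
  have hM0 : 0 ≤ M := by positivity
  refine ⟨2 / a * M + 1, by positivity, ?_⟩
  intro x₀ _ V u hV hu
  have hu0 := sol_nonneg ha hV hu
  obtain ⟨h1, h2, h3⟩ := hu
  have huc : ∀ x ∈ Omega, ContDiffAt ℝ 2 u x := fun x hx =>
    h1.contDiffAt (Filter.mem_of_superset (isOpen_Omega.mem_nhds hx) subset_closure)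
  set w : E2 → ℝ := fun x => χ x * u x with hw
  have hwc : ContDiff ℝ 2 w := by
    rw [contDiff_iff_contDiffAt]
    intro x
    by_cases hx : x ∈ tsupport χ
    · exact hχ.contDiffAt.mul (huc x (hχO hx))
    · have : w =ᶠ[nhds x] fun _ => 0 := by
        filter_upwards [(isClosed_tsupport χ).isOpen_compl.mem_nhds hx] with y hy
        simp [hw, image_eq_zero_of_notMem_tsupport hy]
      exact contDiffAt_const.congr_of_eventuallyEq this
  have hwu : ∀ x ∈ L, w =ᶠ[nhds x] u := fun x hx => by
    have := hχ1.filter_mono (nhds_le_nhdsSet hx)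
    filter_upwards [this] with y hy
    simp [hw, hy]
  have hlapw : ∀ x ∈ L, lap w x = lap u x := fun x hx => by
    unfold lap
    rw [((hwu x hx).iteratedFDeriv ℝ 2).eq_of_nhds]
  -- continuity
  have clap : ∀ {f : E2 → ℝ}, ContDiff ℝ 2 f → Continuous (lap f) := fun {f} hf => by
    rw [show lap f = fun x => ∑ i : Fin 2, dirD (EuclideanSpace.single i 1)
      (dirD (EuclideanSpace.single i 1) f) x from funext fun x => lap_eq hf.contDiffAt]
    exact continuous_finsetSum _ fun i _ =>
      (dirD_smooth _ (dirD_smooth _ hf (m := 1) (by norm_num)) (m := 0) (by norm_num)).continuous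
  have green : ∫ x, φ x * lap w x = ∫ x, lap φ x * w x := by
    have e1 : ∀ x, φ x * lap w x = ∑ i : Fin 2, φ x * dirD (EuclideanSpace.single i 1)
      (dirD (EuclideanSpace.single i 1) w) x := fun x => by
      rw [lap_eq hwc.contDiffAt, Finset.mul_sum]
    have e2 : ∀ x, lap φ x * w x = ∑ i : Fin 2, dirD (EuclideanSpace.single i 1)
      (dirD (EuclideanSpace.single i 1) φ) x * w x := fun x => by
      rw [lap_eq hφ.contDiffAt, Finset.sum_mul]
    simp_rw [e1, e2]
    rw [integral_finsetSum, integral_finsetSum]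
    · exact Finset.sum_congr rfl fun i _ => intByParts2 _ hφ hwc hφs
    · intro i _
      refine Continuous.integrable_of_hasCompactSupport ?_
        ((dirD_supp _ (dirD_supp _ hφs)).mul_right)
      exact ((dirD_smooth _ (dirD_smooth _ hφ (m := 1) (by norm_num)) (m := 0)
        (by norm_num)).continuous).mul hwc.continuous
    · intro i _
      refine Continuous.integrable_of_hasCompactSupport ?_ (hφs.mul_right)
      exact hφ.continuous.mul ((dirD_smooth _ (dirD_smooth _ hwc (m := 1) (by norm_num)) (m := 0)
        (by norm_num)).continuous)
  have hLφ : ∀ x, x ∉ L → lap φ x = 0 := fun x hx => by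
    have := hlapφ x
    rw [hφz x hx] at this
    simpa using this
  have s1 : ∫ x in L, φ x * lap w x = ∫ x, φ x * lap w x :=
    setIntegral_eq_integral_of_forall_compl_eq_zero fun x hx => by simp [hφdef, hφz x hx]
  have s2 : ∫ x in L, lap φ x * w x = ∫ x, lap φ x * w x :=
    setIntegral_eq_integral_of_forall_compl_eq_zero fun x hx => by simp [hLφ x hx]
  have hucont : ContinuousOn u L := h1.continuousOn.mono (hψO.trans subset_closure)
  have hec : ContinuousOn (fun x => Real.exp (u x)) L := Real.continuous_exp.comp_continuousOn hucont
  have hepc : IntegrableOn (fun x => Real.exp (u x) * φ x) L :=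
    (hec.mul hφ.continuous.continuousOn).integrableOn_compact hL
  have hLm : MeasurableSet L := hL.measurableSet
  set J : ℝ := ∫ x in L, Real.exp (u x) * φ x with hJ
  -- lower bound
  have low : a * J ≤ ∫ x in L, -(φ x * lap w x) := by
    rw [hJ, ← integral_const_mul]
    refine setIntegral_mono_on (hepc.const_mul a) ?_ hLm ?_
    · exact ((hφ.continuous.mul (clap hwc)).neg).continuousOn.integrableOn_compact hL
    · intro x hx
      have hxO := hψO hx
      rw [hlapw x hx, ← mul_neg, h3 x hxO]
      have hVx := (hV x (subset_closure hxO)).1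
      have hφx : 0 ≤ φ x := pow_nonneg (hψ0 x) 4
      have hr : 0 ≤ ‖x - x₀‖ ^ (2 * β) := by positivity
      have h4 : a ≤ (1 + ‖x - x₀‖ ^ (2 * β)) * V x := by nlinarith
      have h5 := mul_le_mul_of_nonneg_right h4 (mul_nonneg hφx (Real.exp_pos (u x)).le)
      linarith
  have up : ∫ x in L, -(lap φ x * w x) ≤ a / 2 * J + M := by
    have : a / 2 * J + M = ∫ x in L, (a / 2 * (Real.exp (u x) * φ x) + 2 * Q ^ 2 / a) := by
      rw [integral_add (hepc.const_mul _) (integrableOn_const hL.measure_lt_top.ne),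
        integral_const_mul, setIntegral_const, smul_eq_mul, hM, Measure.real, mul_comm (volume L).toReal]
    rw [this]
    refine setIntegral_mono_on ?_ ?_ hLm ?_
    · exact (((clap hφ).mul hwc.continuous).neg).continuousOn.integrableOn_compact hL
    · exact (hepc.const_mul _).add (integrableOn_const hL.measure_lt_top.ne)
    · intro x hx
      have hwx : w x = u x := (hwu x hx).eq_of_nhds
      rw [hwx]
      have hux := hu0 x (hψO hx)
      set s := Real.exp (u x / 2) with hs
      have hs2 : Real.exp (u x) = s ^ 2 := by
        rw [hs, ← Real.exp_nat_mul]; congr 1; push_cast; ring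
      have hus : u x ≤ 2 * s := by
        have := Real.add_one_le_exp (u x / 2)
        linarith
      have hQx : 0 ≤ Q * ψ x ^ 2 := (abs_nonneg _).trans (hlapφ x)
      have t1 : -(lap φ x * u x) ≤ Q * ψ x ^ 2 * (2 * s) := by
        calc -(lap φ x * u x) ≤ |lap φ x| * u x := by
              have := neg_abs_le (lap φ x)
              nlinarith
          _ ≤ Q * ψ x ^ 2 * u x := mul_le_mul_of_nonneg_right (hlapφ x) hux
          _ ≤ _ := mul_le_mul_of_nonneg_left hus hQx
      refine t1.trans ?_
      rw [hs2, hφdef]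
      have t2 : a / 2 * (s ^ 2 * ψ x ^ 4) + 2 * Q ^ 2 / a - Q * ψ x ^ 2 * (2 * s)
          = (a * (s * ψ x ^ 2) - 2 * Q) ^ 2 / (2 * a) := by
        field_simp
        ring
      have : 0 ≤ (a * (s * ψ x ^ 2) - 2 * Q) ^ 2 / (2 * a) := by positivity
      simp only
      linarith
  rw [integral_neg, s1, green] at low
  rw [integral_neg, s2] at up
  have hJM : J ≤ 2 / a * M := by
    have h : a * J ≤ 2 * M := by linarith
    rw [div_mul_eq_mul_div, le_div_iff₀ ha]
    linarith
  have hKJ : ∫ x in K, Real.exp (u x) ≤ J := by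
    have e : ∫ x in K, Real.exp (u x) = ∫ x in K, Real.exp (u x) * φ x :=
      setIntegral_congr_fun hK.measurableSet fun x hx => by
        simp [hφdef, hψ1.self_of_nhdsSet x hx]
    rw [e]
    refine setIntegral_mono_set hepc ?_ hKL.eventuallyLE
    exact Filter.Eventually.of_forall fun x =>
      mul_nonneg (Real.exp_pos _).le (pow_nonneg (hψ0 x) 4)
  linarith
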